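/- Let (X,𝓔) be a coarse space with basepoint x₀. For every K ∈ 𝓔 and all y, a, a' ∈ ∗X, D*_K(y·a, y·a') = D*_K(a, a'); i.e., left concatenation by any fixed word y is an isometry of (∗X, D*_K). Consequently, for any A ⊆ ∗X, any Y ⊆ ∗X, and any entourage L ∈ ∗𝓔, the set {(y·a, y·a') : y ∈ Y, (a,a') ∈ L ∩ (A × A)} is an entourage of ∗𝓔. -/

import Mathlib

open Set

universe u v

/-- Composition of two relations. -/
def rcomp {X : Type u} (E F : Set (X × X)) : Set (X × X) :=
  {p | ∃ y, (p.1, y) ∈ E ∧ (y, p.2) ∈ F}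

/-- A collection of subsets of `X × X` is a coarse structure if it contains the diagonal and
is closed under inverses, finite unions, subsets and compositions. -/
def IsCoarseStructure {X : Type u} (𝓔 : Set (Set (X × X))) : Prop :=
  {p : X × X | p.1 = p.2} ∈ 𝓔 ∧
    (∀ E ∈ 𝓔, Prod.swap '' E ∈ 𝓔) ∧
    (∀ E ∈ 𝓔, ∀ F ∈ 𝓔, E ∪ F ∈ 𝓔) ∧
    (∀ E ∈ 𝓔, ∀ F, F ⊆ E → F ∈ 𝓔) ∧
    (∀ E ∈ 𝓔, ∀ F ∈ 𝓔, rcomp E F ∈ 𝓔)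

/-- `compIter E k` is the `k`-fold composition `E ∘ E ∘ ⋯ ∘ E`, with `E^0 = E ∩ Δ`. -/
def compIter {X : Type u} (E : Set (X × X)) : ℕ → Set (X × X)
  | 0 => E ∩ {p | p.1 = p.2}
  | 1 => E
  | k + 2 => rcomp E (compIter E (k + 1))

/-- `DE E x y = min {k : (x,y) ∈ E^k}`, with value `∞` if there is no such `k`. -/
noncomputable def DE {X : Type u} (E : Set (X × X)) (x y : X) : ℕ∞ :=
  sInf {n : ℕ∞ | ∃ k : ℕ, n = (k : ℕ∞) ∧ (x, y) ∈ compIter E k}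

/-- The free product `∗X`: finite words in the alphabet `X \ {x₀}`. -/
def FreeWord (X : Type u) (x₀ : X) : Type u := {l : List X // x₀ ∉ l}

/-- Concatenation of words. -/
def FreeWord.concat {X : Type u} {x₀ : X} (x y : FreeWord X x₀) : FreeWord X x₀ :=
  ⟨x.1 ++ y.1, fun h => (List.mem_append.mp h).elim x.2 y.2⟩

/-- The order (length) of a word. -/
def FreeWord.ord {X : Type u} {x₀ : X} (x : FreeWord X x₀) : ℕ := x.1.length

/-- The empty word `ε`. -/
def FreeWord.epsilon (X : Type u) (x₀ : X) : FreeWord X x₀ := ⟨[], by simp⟩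

/-- The one-letter word on a letter `u ≠ x₀`. -/
def FreeWord.single {X : Type u} {x₀ : X} (u : X) (h : u ≠ x₀) : FreeWord X x₀ :=
  ⟨[u], by simp only [List.mem_singleton]; exact fun hh => h hh.symm⟩

/-- `‖x₁⋯x_k‖_E = Σᵢ D_E(x₀, xᵢ)`. -/
noncomputable def wnormL {X : Type u} (E : Set (X × X)) (x₀ : X) (l : List X) : ℕ∞ :=
  (l.map fun a => DE E x₀ a).sum

/-- `‖x₁⋯x_k‖^E = Σᵢ D_E(xᵢ, x₀)`. -/
noncomputable def wnormR {X : Type u} (E : Set (X × X)) (x₀ : X) (l : List X) : ℕ∞ :=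
  (l.map fun a => DE E a x₀).sum

open Classical in
/-- `D*_E` on underlying lists: equal words are at distance `0`; otherwise strip the longest
common prefix `a`, at the first difference `x = a·b·c`, `x' = a·b'·c'` (with `b = x₀` and `c = ε`
when a word has run out) the value is `D_E(b,b') + ‖c‖_E + ‖c'‖^E`. -/
noncomputable def DstarList {X : Type u} (E : Set (X × X)) (x₀ : X) :
    List X → List X → ℕ∞
  | [], [] => 0
  | [], b :: t => DE E x₀ b + wnormR E x₀ t
  | a :: s, [] => DE E a x₀ + wnormL E x₀ s
  | a :: s, b :: t =>
      if a = b then DstarList E x₀ s t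
      else DE E a b + wnormL E x₀ s + wnormR E x₀ t

/-- `D*_E` on the free product `∗X`. -/
noncomputable def Dstar {X : Type u} (E : Set (X × X)) (x₀ : X)
    (x y : FreeWord X x₀) : ℕ∞ :=
  DstarList E x₀ x.1 y.1

/-- `⟨E,n⟩ = {(x,x') : D*_E(x,x') ≤ n}`. -/
def bracket {X : Type u} (E : Set (X × X)) (x₀ : X) (n : ℕ) :
    Set (FreeWord X x₀ × FreeWord X x₀) :=
  {p | Dstar E x₀ p.1 p.2 ≤ (n : ℕ∞)}

/-- The coarse free product structure `∗𝓔`: the subset closure of the sets `⟨E,n⟩`. -/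
def freeEnts {X : Type u} (𝓔 : Set (Set (X × X))) (x₀ : X) :
    Set (Set (FreeWord X x₀ × FreeWord X x₀)) :=
  {L | ∃ E ∈ 𝓔, ∃ n : ℕ, L ⊆ bracket E x₀ n}

/-- A family of subsets is `E`-disjoint if products of distinct members miss `E`. -/
def EDisjointFam {Y : Type v} (𝒰 : Set (Set Y)) (E : Set (Y × Y)) : Prop :=
  ∀ U ∈ 𝒰, ∀ V ∈ 𝒰, U ≠ V → ∀ u ∈ U, ∀ v ∈ V, (u, v) ∉ E

/-- A family of subsets is `K`-bounded if `∪ U × U ⊆ K`. -/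
def KBoundedFam {Y : Type v} (𝒰 : Set (Set Y)) (K : Set (Y × Y)) : Prop :=
  ∀ U ∈ 𝒰, ∀ u ∈ U, ∀ v ∈ U, (u, v) ∈ K

/-- Asymptotic dimension at most `n` of a space with entourage collection `ents`. -/
def AsdimLE {Y : Type v} (ents : Set (Set (Y × Y))) (n : ℕ) : Prop :=
  ∀ E ∈ ents, ∃ K ∈ ents, ∃ 𝒰 : Fin (n + 1) → Set (Set Y),
    (∀ y : Y, ∃ i, ∃ V ∈ 𝒰 i, y ∈ V) ∧
    (∀ i, EDisjointFam (𝒰 i) E) ∧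
    (∀ i, KBoundedFam (𝒰 i) K)

/-- The subspace coarse structure on `A ⊆ Y`. -/
def subEnts {Y : Type v} (ents : Set (Set (Y × Y))) (A : Set Y) :
    Set (Set (↥A × ↥A)) :=
  {L | (Prod.map ((↑) : A → Y) ((↑) : A → Y)) '' L ∈ ents}

/-- Entourages of the total space `T({U_i}; J) = ⊔ᵢ Uᵢ` of a family of subsets. -/
def totalEnts {Y : Type v} {J : Type*} (ents : Set (Set (Y × Y))) (U : J → Set Y) :
    Set (Set ((Σ i : J, ↥(U i)) × (Σ i : J, ↥(U i)))) :=
  {L | ∃ E ∈ ents, ∀ p ∈ L, p.1.1 = p.2.1 ∧ ((p.1.2 : Y), (p.2.2 : Y)) ∈ E}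

/-- A family `{U_i}` has asymptotic dimension at most `m` uniformly if its total space does. -/
def UniformAsdimLE {Y : Type v} {J : Type*} (ents : Set (Set (Y × Y)))
    (U : J → Set Y) (m : ℕ) : Prop :=
  AsdimLE (totalEnts ents U) m

/-- The symmetric ball `B(x₀, E)`. -/
def symmBall {X : Type u} (E : Set (X × X)) (x₀ : X) : Set X :=
  {y | (x₀, y) ∈ E ∨ (y, x₀) ∈ E}

/-- The `M`-cone `con_M(A) = A · (∗B(x₀,M))`. -/
def cone {X : Type u} (M : Set (X × X)) (x₀ : X) (A : Set (FreeWord X x₀)) :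
    Set (FreeWord X x₀) :=
  {z | ∃ a ∈ A, ∃ w : FreeWord X x₀, (∀ c ∈ w.1, c ∈ symmBall M x₀) ∧ z = a.concat w}

@[simp]
theorem DstarList_append_left {X : Type u} (E : Set (X × X)) (x₀ : X) (l s t : List X) :
    DstarList E x₀ (l ++ s) (l ++ t) = DstarList E x₀ s t := by
  induction l with
  | nil => rfl
  | cons b l ih => simpa [DstarList] using ih

theorem Dstar_concat_left {X : Type u} (E : Set (X × X)) {x₀ : X} (y a a' : FreeWord X x₀) :
    Dstar E x₀ (y.concat a) (y.concat a') = Dstar E x₀ a a' :=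
  DstarList_append_left E x₀ y.1 a.1 a'.1

/-- Left concatenation is a `D*_K`-isometry; consequently translates of a restricted
entourage form an entourage of `∗𝓔`. -/
theorem concat_isometry_and_translates_entourage
    {X : Type u} (𝓔 : Set (Set (X × X))) (h𝓔 : IsCoarseStructure 𝓔) (x₀ : X) :
    (∀ K ∈ 𝓔, ∀ y a a' : FreeWord X x₀,
      Dstar K x₀ (y.concat a) (y.concat a') = Dstar K x₀ a a') ∧
    (∀ A Y : Set (FreeWord X x₀), ∀ L ∈ freeEnts 𝓔 x₀,
      {p : FreeWord X x₀ × FreeWord X x₀ |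
        ∃ y ∈ Y, ∃ a ∈ A, ∃ a' ∈ A, (a, a') ∈ L ∧ p = (y.concat a, y.concat a')}
        ∈ freeEnts 𝓔 x₀) := by
  refine ⟨fun K _ => Dstar_concat_left K, ?_⟩
  rintro A Y L ⟨E, hE, n, hL⟩
  refine ⟨E, hE, n, ?_⟩
  rintro _ ⟨y, -, a, -, a', -, haa', rfl⟩
  exact (Dstar_concat_left E y a a').trans_le (hL haa')
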